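/- arXiv:2503.01153 — 5 statements merged into one kernel-verified Lean document; each statement's English description precedes it below -/
import Mathlib

section
/- Let W_B be the subgroup of Aut(Pic) generated by s0 = w0, s1 = w2, s2 = w3, s3 = σ3. Then the setwise stabilizer {w ∈ W_B : w({α2, δ−α2}) = {α2, δ−α2}} equals the subgroup of W_B generated by the five elements s0, s2∘s1∘s3∘s2∘s3∘s1∘s2, s3, s2∘s1∘s0∘s2∘s3∘s2∘s0∘s1∘s2, and g = s2∘s1∘s3∘s0∘s2; equivalently it equals N ∪ N·g, where N = {w ∈ W_B : w(α2) = α2}. -/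
open Pointwise

/-- The Picard lattice `Pic`, with basis `H1, H2, E1, …, E8`
(coordinates `0 ↦ H1`, `1 ↦ H2`, `i+1 ↦ Eᵢ`). -/
abbrev Pic : Type := Fin 10 → ℤ

/-- The intersection form `•` : `H1•H2 = 1`, `Eᵢ•Eᵢ = -1`, all other pairings
of basis vectors being `0`. -/
def inter (x y : Pic) : ℤ :=
  x 0 * y 1 + x 1 * y 0 -
    (x 2 * y 2 + x 3 * y 3 + x 4 * y 4 + x 5 * y 5 + x 6 * y 6 +
      x 7 * y 7 + x 8 * y 8 + x 9 * y 9)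

/-- The `j`-th basis vector of `Pic`. -/
def bvec (j : Fin 10) : Pic := fun k => if k = j then 1 else 0

/-- The matrix of the reflection `C ↦ C + (C • a)·a` in `a`. -/
def reflMat (a : Pic) : Matrix (Fin 10) (Fin 10) ℤ :=
  Matrix.of fun k j => (if k = j then 1 else 0) + inter (bvec j) a * a k

/-- The matrix of the linear map sending the basis vector `e j` to `e (p j)`. -/
def permMat (p : Fin 10 → Fin 10) : Matrix (Fin 10) (Fin 10) ℤ :=
  Matrix.of fun k j => if p j = k then 1 else 0

/-- `α₀ = H2 - E1 - E2`. -/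
def al0 : Pic := ![0, 1, -1, -1, 0, 0, 0, 0, 0, 0]
/-- `α₁ = H1 - E5 - E6`. -/
def al1 : Pic := ![1, 0, 0, 0, 0, 0, -1, -1, 0, 0]
/-- `α₂ = H2 - E3 - E4`. -/
def al2 : Pic := ![0, 1, 0, 0, -1, -1, 0, 0, 0, 0]
/-- `α₃ = H1 - E7 - E8`. -/
def al3 : Pic := ![1, 0, 0, 0, 0, 0, 0, 0, -1, -1]
/-- `δ = 2H1 + 2H2 - E1 - ⋯ - E8`. -/
def dl : Pic := ![2, 2, -1, -1, -1, -1, -1, -1, -1, -1]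
/-- `μ = H1 - H2`. -/
def mu : Pic := ![1, -1, 0, 0, 0, 0, 0, 0, 0, 0]

/-- Automorphisms of the lattice `Pic`, realized as invertible integer `10 × 10`
matrices (acting on coordinate vectors by matrix-vector multiplication). -/
abbrev PicAut : Type := (Matrix (Fin 10) (Fin 10) ℤ)ˣ

/-- Build an automorphism of `Pic` out of an involutive matrix. -/
def mkAut (M : Matrix (Fin 10) (Fin 10) ℤ) (h : M * M = 1) : PicAut := ⟨M, M, h, h⟩

/-- `w₀`, the reflection `C ↦ C + (C•α₀)α₀`. -/
def w0 : PicAut := mkAut (reflMat al0) (by decide)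
/-- `w₁`, the reflection `C ↦ C + (C•α₁)α₁`. -/
def w1 : PicAut := mkAut (reflMat al1) (by decide)
/-- `w₂`, the reflection `C ↦ C + (C•α₂)α₂`. -/
def w2 : PicAut := mkAut (reflMat al2) (by decide)
/-- `w₃`, the reflection `C ↦ C + (C•α₃)α₃`. -/
def w3 : PicAut := mkAut (reflMat al3) (by decide)
/-- `σ₁`: the basis permutation `E1↔E7, E2↔E8, E3↔E5, E4↔E6` (fixing `H1`, `H2`)
composed with the reflection `w_μ` in `μ = H1 - H2`. -/
def sg1 : PicAut := mkAut (permMat ![0, 1, 8, 9, 6, 7, 4, 5, 2, 3] * reflMat mu) (by decide)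
/-- `σ₂`: the basis permutation `E1↔E3, E2↔E4` (fixing the other basis vectors). -/
def sg2 : PicAut := mkAut (permMat ![0, 1, 4, 5, 2, 3, 6, 7, 8, 9]) (by decide)
/-- `σ₃`: the basis permutation `E5↔E7, E6↔E8` (fixing the other basis vectors). -/
def sg3 : PicAut := mkAut (permMat ![0, 1, 2, 3, 4, 5, 8, 9, 6, 7]) (by decide)

/-- The action of an automorphism on `Pic`. -/
def act (g : PicAut) (v : Pic) : Pic := g.val.mulVec v

instance : MulAction PicAut Pic where
  smul := act
  one_smul v := by
    show act 1 v = v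
    simp [act]
  mul_smul g h v := by
    show act (g * h) v = act g (act h v)
    simp [act, Matrix.mulVec_mulVec]

lemma smul_eq_act (g : PicAut) (v : Pic) : g • v = act g v := rfl

/-- The fully extended affine Weyl group `Ŵ` of type `A₃⁽¹⁾`, i.e. the subgroup
of automorphisms of `Pic` generated by `w₀, w₁, w₂, w₃, σ₁, σ₂`. -/
def Wh : Subgroup PicAut := Subgroup.closure {w0, w1, w2, w3, sg1, sg2}

/-- `W_B`, generated by `s₀ = w₀, s₁ = w₂, s₂ = w₃, s₃ = σ₃`. -/
def WB : Subgroup PicAut := Subgroup.closure {w0, w2, w3, sg3}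

/-- `s₂s₁s₃s₂s₃s₁s₂`. -/
def a2e : PicAut := w3 * w2 * sg3 * w3 * sg3 * w2 * w3
/-- `s₂s₁s₀s₂s₃s₂s₀s₁s₂`. -/
def b2e : PicAut := w3 * w2 * w0 * w3 * sg3 * w3 * w0 * w2 * w3
/-- `g = s₂s₁s₃s₀s₂`. -/
def ge : PicAut := w3 * w2 * sg3 * w0 * w3

/-- The two-element set `{α₂, δ - α₂} ⊆ Pic`. -/
def Spair2 : Set Pic := {al2, dl - al2}

lemma act_one (v : Pic) : act 1 v = v := Matrix.one_mulVec v

lemma act_mul (g h : PicAut) (v : Pic) : act (g * h) v = act g (act h v) :=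
  (Matrix.mulVec_mulVec v g.val h.val).symm

lemma act_add (g : PicAut) (v w : Pic) : act g (v + w) = act g v + act g w :=
  Matrix.mulVec_add _ v w

lemma act_sub (g : PicAut) (v w : Pic) : act g (v - w) = act g v - act g w :=
  Matrix.mulVec_sub _ v w

lemma act_zsmul (g : PicAut) (k : ℤ) (v : Pic) : act g (k • v) = k • act g v :=
  Matrix.mulVec_smul _ k v

lemma act_inv_eq_iff {g : PicAut} {v w : Pic} : act g⁻¹ v = w ↔ v = act g w := by
  constructor
  · rintro rfl
    rw [← act_mul, mul_inv_cancel, act_one]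
  · rintro rfl
    rw [← act_mul, inv_mul_cancel, act_one]

lemma mem_stabilizer_iff_act {g : PicAut} {v : Pic} :
    g ∈ MulAction.stabilizer PicAut v ↔ act g v = v := Iff.rfl

lemma act_dl_of_mem_WB {w : PicAut} (hw : w ∈ WB) : act w dl = dl := by
  have h : WB ≤ MulAction.stabilizer PicAut dl := by
    refine (Subgroup.closure_le _).2 ?_
    rintro _ (rfl | rfl | rfl | rfl) <;> exact mem_stabilizer_iff_act.2 (by decide)
  exact mem_stabilizer_iff_act.1 (h hw)

/-- An automorphism fixing `δ` stabilizes `{α₂, δ - α₂}` as soon as it maps `α₂` into it. -/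
lemma mem_stabilizer_Spair2_iff {w : PicAut} (hw : act w dl = dl) :
    w ∈ MulAction.stabilizer PicAut Spair2 ↔ act w al2 = al2 ∨ act w al2 = dl - al2 := by
  have himage : w ∈ MulAction.stabilizer PicAut Spair2 ↔ act w '' Spair2 = Spair2 := Iff.rfl
  have hpair : act w '' Spair2 = {act w al2, dl - act w al2} := by
    rw [Spair2, Set.image_pair, act_sub, hw]
  rw [himage, hpair]
  constructor
  · intro h
    have hmem : act w al2 ∈ Spair2 := h ▸ Set.mem_insert _ _
    exact hmem
  · rintro (h | h)
    · rw [h, Spair2]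
    · rw [h, Spair2, sub_sub_cancel, Set.pair_comm]

lemma w0_mem_WB : w0 ∈ WB := Subgroup.subset_closure (by simp)
lemma w2_mem_WB : w2 ∈ WB := Subgroup.subset_closure (by simp)
lemma w3_mem_WB : w3 ∈ WB := Subgroup.subset_closure (by simp)
lemma sg3_mem_WB : sg3 ∈ WB := Subgroup.subset_closure (by simp)

lemma a2e_mem_WB : a2e ∈ WB := by
  unfold a2e
  exact mul_mem (mul_mem (mul_mem (mul_mem (mul_mem (mul_mem w3_mem_WB w2_mem_WB) sg3_mem_WB)
    w3_mem_WB) sg3_mem_WB) w2_mem_WB) w3_mem_WB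

lemma b2e_mem_WB : b2e ∈ WB := by
  unfold b2e
  exact mul_mem (mul_mem (mul_mem (mul_mem (mul_mem (mul_mem (mul_mem (mul_mem w3_mem_WB
    w2_mem_WB) w0_mem_WB) w3_mem_WB) sg3_mem_WB) w3_mem_WB) w0_mem_WB) w2_mem_WB) w3_mem_WB

lemma ge_mem_WB : ge ∈ WB := by
  unfold ge
  exact mul_mem (mul_mem (mul_mem (mul_mem w3_mem_WB w2_mem_WB) sg3_mem_WB) w0_mem_WB) w3_mem_WB

/-- The subgroup generated by `s₀`, `s₂s₁s₃s₂s₃s₁s₂`, `s₃`, `s₂s₁s₀s₂s₃s₂s₀s₁s₂` and `g`. -/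
def pairGroup : Subgroup PicAut := Subgroup.closure {w0, a2e, sg3, b2e, ge}

lemma w0_mem_pairGroup : w0 ∈ pairGroup := Subgroup.subset_closure (by simp)
lemma a2e_mem_pairGroup : a2e ∈ pairGroup := Subgroup.subset_closure (by simp)
lemma sg3_mem_pairGroup : sg3 ∈ pairGroup := Subgroup.subset_closure (by simp)
lemma b2e_mem_pairGroup : b2e ∈ pairGroup := Subgroup.subset_closure (by simp)
lemma ge_mem_pairGroup : ge ∈ pairGroup := Subgroup.subset_closure (by simp)

lemma pairGroup_le : pairGroup ≤ WB ⊓ MulAction.stabilizer PicAut Spair2 := by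
  refine (Subgroup.closure_le _).2 ?_
  have hWB : ∀ x ∈ ({w0, a2e, sg3, b2e, ge} : Set PicAut), x ∈ WB := by
    rintro _ (rfl | rfl | rfl | rfl | rfl)
    exacts [w0_mem_WB, a2e_mem_WB, sg3_mem_WB, b2e_mem_WB, ge_mem_WB]
  intro x hx
  refine ⟨hWB x hx, (mem_stabilizer_Spair2_iff (act_dl_of_mem_WB (hWB x hx))).2 ?_⟩
  rcases hx with rfl | rfl | rfl | rfl | rfl <;> decide +kernel

lemma w2_mul_self : w2 * w2 = 1 := Units.ext w2.val_inv
lemma w3_mul_self : w3 * w3 = 1 := Units.ext w3.val_inv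
lemma sg3_mul_self : sg3 * sg3 = 1 := Units.ext sg3.val_inv
lemma ge_mul_self : ge * ge = 1 := Units.ext (by decide +kernel)

/-- The element `s₁g`, which acts on `α₂` as the translation `α₂ ↦ α₂ + δ`. -/
def trl : PicAut := w2 * ge

lemma trl_inv : trl⁻¹ = ge * w2 := by
  rw [inv_eq_iff_mul_eq_one, trl, mul_assoc, ← mul_assoc ge, ge_mul_self, one_mul, w2_mul_self]

lemma act_trl_zpow_al2 (k : ℤ) : act (trl ^ k) al2 = al2 + k • dl := by
  have hdl : act trl dl = dl := act_dl_of_mem_WB (mul_mem w2_mem_WB ge_mem_WB)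
  have hal : act trl al2 = al2 + dl := by decide +kernel
  have hal' : act trl⁻¹ al2 = al2 - dl := by
    rw [act_inv_eq_iff, act_sub, hal, hdl, add_sub_cancel_right]
  induction k using Int.induction_on with
  | zero => rw [zpow_zero, act_one, zero_smul, add_zero]
  | succ n ih =>
    rw [zpow_add_one, act_mul, hal, act_add, ih, add_assoc, add_smul, one_smul]
    congr 2
    exact mem_stabilizer_iff_act.1 (zpow_mem (mem_stabilizer_iff_act.2 hdl) _)
  | pred n ih =>
    rw [zpow_sub_one, act_mul, hal', act_sub, ih, sub_smul, one_smul, ← add_sub_assoc]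
    congr 1
    exact mem_stabilizer_iff_act.1 (zpow_mem (mem_stabilizer_iff_act.2 hdl) _)

/-- If conjugation by `t` interchanges `x` and `y`, then conjugation by any power of `t`
takes `x` to `x` or `y`. -/
lemma mul_zpow_eq_or {G : Type*} [Group G] {t x y : G} (hxy : SemiconjBy t x y)
    (hyx : SemiconjBy t y x) (k : ℤ) :
    x * t ^ k = t ^ k * x ∨ x * t ^ k = t ^ k * y := by
  have hc : Commute (t * t) x := hyx.mul_left hxy
  obtain ⟨m, rfl | rfl⟩ := Int.even_or_odd' k
  · left
    rw [zpow_mul, zpow_two]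
    exact (hc.zpow_left m).eq.symm
  · right
    rw [zpow_add_one, zpow_mul, zpow_two]
    exact ((show SemiconjBy _ x x from hc.zpow_left m).mul_left hyx).eq.symm

/-- If conjugation by `x` inverts `t`, then it inverts the powers of `t`. -/
lemma mul_zpow_of_inverts {G : Type*} [Group G] {t x : G} (h : x * t = t⁻¹ * x) (k : ℤ) :
    x * t ^ k = t ^ (-k) * x := by
  rw [zpow_neg, ← inv_zpow]
  exact SemiconjBy.zpow_right (show SemiconjBy x t t⁻¹ from h) k

/-- The products of a power of `s₁g` and an element of `pairGroup`. -/
def trlSet : Set PicAut := {x | ∃ k : ℤ, ∃ h ∈ pairGroup, x = trl ^ k * h}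

lemma mul_mem_trlSet_of_semiconj {x y z : PicAut} (hx : x ∈ pairGroup) (hy : y ∈ pairGroup)
    (hxy : SemiconjBy trl x y) (hyx : SemiconjBy trl y x) (hz : z ∈ trlSet) :
    x * z ∈ trlSet := by
  obtain ⟨k, h, hh, rfl⟩ := hz
  rcases mul_zpow_eq_or hxy hyx k with e | e
  · exact ⟨k, x * h, mul_mem hx hh, by rw [← mul_assoc, e, mul_assoc]⟩
  · exact ⟨k, y * h, mul_mem hy hh, by rw [← mul_assoc, e, mul_assoc]⟩

lemma ge_mul_mem_trlSet {z : PicAut} (hz : z ∈ trlSet) : ge * z ∈ trlSet := by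
  obtain ⟨k, h, hh, rfl⟩ := hz
  refine ⟨-k, ge * h, mul_mem ge_mem_pairGroup hh, ?_⟩
  rw [← mul_assoc, mul_zpow_of_inverts (by rw [trl_inv, trl, mul_assoc]), mul_assoc]

lemma w2_mul_mem_trlSet {z : PicAut} (hz : z ∈ trlSet) : w2 * z ∈ trlSet := by
  obtain ⟨k, h, hh, hz⟩ := ge_mul_mem_trlSet hz
  refine ⟨1 + k, h, hh, ?_⟩
  rw [zpow_one_add, mul_assoc, ← hz, trl, mul_assoc, ← mul_assoc ge, ge_mul_self, one_mul]

lemma semiconjBy_trl_w0 : SemiconjBy trl w0 a2e := Units.ext (by decide +kernel)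
lemma semiconjBy_trl_a2e : SemiconjBy trl a2e w0 := Units.ext (by decide +kernel)
lemma semiconjBy_trl_sg3 : SemiconjBy trl sg3 b2e := Units.ext (by decide +kernel)
lemma semiconjBy_trl_b2e : SemiconjBy trl b2e sg3 := Units.ext (by decide +kernel)

lemma w0_mul_mem_trlSet {z : PicAut} (hz : z ∈ trlSet) : w0 * z ∈ trlSet :=
  mul_mem_trlSet_of_semiconj w0_mem_pairGroup a2e_mem_pairGroup
    semiconjBy_trl_w0 semiconjBy_trl_a2e hz

lemma a2e_mul_mem_trlSet {z : PicAut} (hz : z ∈ trlSet) : a2e * z ∈ trlSet :=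
  mul_mem_trlSet_of_semiconj a2e_mem_pairGroup w0_mem_pairGroup
    semiconjBy_trl_a2e semiconjBy_trl_w0 hz

lemma sg3_mul_mem_trlSet {z : PicAut} (hz : z ∈ trlSet) : sg3 * z ∈ trlSet :=
  mul_mem_trlSet_of_semiconj sg3_mem_pairGroup b2e_mem_pairGroup
    semiconjBy_trl_sg3 semiconjBy_trl_b2e hz

/-- Representatives for the cosets in `W_B` of the stabilizer of `{±α₂}` modulo `δ`. -/
def cosetReps : Set PicAut :=
  {1, w3, sg3 * w3, w3 * sg3 * w3, w2 * w3, sg3 * w2 * w3}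

/-- The products of a coset representative and an element of `trlSet`. -/
def cosetUnion : Set PicAut := {x | ∃ u ∈ cosetReps, ∃ z ∈ trlSet, x = u * z}

lemma mul_mem_cosetUnion_of_eq {s u u' x z : PicAut} (hu' : u' ∈ cosetReps)
    (e : s * u = u' * x) (hz : x * z ∈ trlSet) : s * (u * z) ∈ cosetUnion :=
  ⟨u', hu', x * z, hz, by rw [← mul_assoc, e, mul_assoc]⟩

lemma w0_mul_mem_cosetUnion {x : PicAut} (hx : x ∈ cosetUnion) : w0 * x ∈ cosetUnion := by
  obtain ⟨u, hu, z, hz, rfl⟩ := hx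
  rcases hu with rfl | rfl | rfl | rfl | rfl | rfl
  · exact mul_mem_cosetUnion_of_eq (u' := 1) (x := w0) (by simp [cosetReps])
      (by rw [mul_one, one_mul]) (w0_mul_mem_trlSet hz)
  · exact mul_mem_cosetUnion_of_eq (u' := sg3 * w2 * w3) (x := ge) (by simp [cosetReps])
      (Units.ext (by decide +kernel)) (ge_mul_mem_trlSet hz)
  · exact mul_mem_cosetUnion_of_eq (u' := w2 * w3) (x := ge) (by simp [cosetReps])
      (Units.ext (by decide +kernel)) (ge_mul_mem_trlSet hz)
  · refine mul_mem_cosetUnion_of_eq (u' := w3 * sg3 * w3) (x := ge * (w2 * ge))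
      (by simp [cosetReps]) (Units.ext (by decide +kernel)) ?_
    rw [mul_assoc, mul_assoc]
    exact ge_mul_mem_trlSet (w2_mul_mem_trlSet (ge_mul_mem_trlSet hz))
  · exact mul_mem_cosetUnion_of_eq (u' := sg3 * w3) (x := ge) (by simp [cosetReps])
      (Units.ext (by decide +kernel)) (ge_mul_mem_trlSet hz)
  · exact mul_mem_cosetUnion_of_eq (u' := w3) (x := ge) (by simp [cosetReps])
      (Units.ext (by decide +kernel)) (ge_mul_mem_trlSet hz)

lemma w2_mul_mem_cosetUnion {x : PicAut} (hx : x ∈ cosetUnion) : w2 * x ∈ cosetUnion := by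
  obtain ⟨u, hu, z, hz, rfl⟩ := hx
  have hz1 : 1 * z ∈ trlSet := by rwa [one_mul]
  rcases hu with rfl | rfl | rfl | rfl | rfl | rfl
  · exact mul_mem_cosetUnion_of_eq (u' := 1) (x := w2) (by simp [cosetReps])
      (by rw [mul_one, one_mul]) (w2_mul_mem_trlSet hz)
  · exact mul_mem_cosetUnion_of_eq (u' := w2 * w3) (by simp [cosetReps]) (mul_one _).symm hz1
  · exact mul_mem_cosetUnion_of_eq (u' := sg3 * w2 * w3) (by simp [cosetReps])
      (Units.ext (by decide +kernel)) hz1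
  · exact mul_mem_cosetUnion_of_eq (u' := w3 * sg3 * w3) (x := a2e) (by simp [cosetReps])
      (Units.ext (by decide +kernel)) (a2e_mul_mem_trlSet hz)
  · exact mul_mem_cosetUnion_of_eq (u' := w3) (by simp [cosetReps])
      (Units.ext (by decide +kernel)) hz1
  · exact mul_mem_cosetUnion_of_eq (u' := sg3 * w3) (by simp [cosetReps])
      (Units.ext (by decide +kernel)) hz1

lemma w3_mul_mem_cosetUnion {x : PicAut} (hx : x ∈ cosetUnion) : w3 * x ∈ cosetUnion := by
  obtain ⟨u, hu, z, hz, rfl⟩ := hx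
  have hz1 : 1 * z ∈ trlSet := by rwa [one_mul]
  rcases hu with rfl | rfl | rfl | rfl | rfl | rfl
  · exact mul_mem_cosetUnion_of_eq (u' := w3) (by simp [cosetReps]) rfl hz1
  · exact mul_mem_cosetUnion_of_eq (u' := 1) (by simp [cosetReps])
      (by rw [w3_mul_self, one_mul]) hz1
  · exact mul_mem_cosetUnion_of_eq (u' := w3 * sg3 * w3) (by simp [cosetReps])
      (by rw [mul_one, mul_assoc]) hz1
  · exact mul_mem_cosetUnion_of_eq (u' := sg3 * w3) (by simp [cosetReps])
      (Units.ext (by decide +kernel)) hz1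
  · exact mul_mem_cosetUnion_of_eq (u' := w2 * w3) (x := w2) (by simp [cosetReps])
      (Units.ext (by decide +kernel)) (w2_mul_mem_trlSet hz)
  · exact mul_mem_cosetUnion_of_eq (u' := sg3 * w2 * w3) (x := a2e) (by simp [cosetReps])
      (Units.ext (by decide +kernel)) (a2e_mul_mem_trlSet hz)

lemma sg3_mul_mem_cosetUnion {x : PicAut} (hx : x ∈ cosetUnion) : sg3 * x ∈ cosetUnion := by
  obtain ⟨u, hu, z, hz, rfl⟩ := hx
  have hz1 : 1 * z ∈ trlSet := by rwa [one_mul]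
  rcases hu with rfl | rfl | rfl | rfl | rfl | rfl
  · exact mul_mem_cosetUnion_of_eq (u' := 1) (x := sg3) (by simp [cosetReps])
      (by rw [mul_one, one_mul]) (sg3_mul_mem_trlSet hz)
  · exact mul_mem_cosetUnion_of_eq (u' := sg3 * w3) (by simp [cosetReps]) (mul_one _).symm hz1
  · exact mul_mem_cosetUnion_of_eq (u' := w3) (by simp [cosetReps])
      (by rw [← mul_assoc, sg3_mul_self, one_mul, mul_one]) hz1
  · exact mul_mem_cosetUnion_of_eq (u' := w3 * sg3 * w3) (x := sg3) (by simp [cosetReps])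
      (Units.ext (by decide +kernel)) (sg3_mul_mem_trlSet hz)
  · exact mul_mem_cosetUnion_of_eq (u' := sg3 * w2 * w3) (by simp [cosetReps])
      (by rw [mul_one, mul_assoc]) hz1
  · exact mul_mem_cosetUnion_of_eq (u' := w2 * w3) (by simp [cosetReps])
      (Units.ext (by decide +kernel)) hz1

lemma mem_cosetUnion_of_mem_WB {w : PicAut} (hw : w ∈ WB) : w ∈ cosetUnion := by
  refine Subgroup.closure_induction_left (p := fun w _ => w ∈ cosetUnion) ?_ ?_ ?_ hw
  · exact ⟨1, by simp [cosetReps], 1, ⟨0, 1, one_mem _, by simp⟩, by simp⟩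
  · rintro _ (rfl | rfl | rfl | rfl) y _ hy
    exacts [w0_mul_mem_cosetUnion hy, w2_mul_mem_cosetUnion hy, w3_mul_mem_cosetUnion hy,
      sg3_mul_mem_cosetUnion hy]
  · rintro _ (rfl | rfl | rfl | rfl) y _ hy
    exacts [w0_mul_mem_cosetUnion hy, w2_mul_mem_cosetUnion hy, w3_mul_mem_cosetUnion hy,
      sg3_mul_mem_cosetUnion hy]

lemma cosetReps_subset_WB : cosetReps ⊆ WB := by
  rintro _ (rfl | rfl | rfl | rfl | rfl | rfl) <;>
    simp only [SetLike.mem_coe, mul_mem, one_mem, w2_mem_WB, w3_mem_WB, sg3_mem_WB]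

/-- The coset representatives move `α₂` to roots that are pairwise distinct up to sign,
modulo `δ`. -/
lemma eq_of_act_al2_add {u : PicAut} (hu : u ∈ cosetReps) {k : ℤ}
    (h : act u al2 + k • dl = al2 ∨ act u al2 + k • dl = dl - al2) : u = 1 ∧ k = 0 := by
  have hal : ∀ v : Pic, act u al2 = v → v + k • dl = al2 ∨ v + k • dl = dl - al2 := by
    rintro _ rfl
    exact h
  have hcoord : ∀ v : Pic, act u al2 = v →
      (∀ i, v i + k * dl i = al2 i) ∨ (∀ i, v i + k * dl i = dl i - al2 i) := fun v hv =>
    (hal v hv).imp (fun e i => congrFun e i) fun e i => congrFun e i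
  rcases hu with rfl | rfl | rfl | rfl | rfl | rfl
  · refine ⟨rfl, ?_⟩
    rcases hcoord al2 (act_one _) with e | e
    · simpa [al2, dl] using e 0
    · have e0 := e 0
      have e4 := e 4
      simp [al2, dl] at e0 e4
      omega
  · rcases hcoord ![1, 1, 0, 0, -1, -1, 0, 0, -1, -1] (by decide) with e | e
    all_goals
      have e0 := e 0
      simp [al2, dl] at e0
      omega
  · rcases hcoord ![1, 1, 0, 0, -1, -1, -1, -1, 0, 0] (by decide) with e | e
    all_goals
      have e0 := e 0
      simp [al2, dl] at e0
      omega
  · rcases hcoord ![2, 1, 0, 0, -1, -1, -1, -1, -1, -1] (by decide) with e | e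
    all_goals
      have e0 := e 0
      have e2 := e 2
      simp [al2, dl] at e0 e2
      omega
  · rcases hcoord ![1, 0, 0, 0, 0, 0, 0, 0, -1, -1] (by decide) with e | e
    all_goals
      have e0 := e 0
      simp [al2, dl] at e0
      omega
  · rcases hcoord ![1, 0, 0, 0, 0, 0, -1, -1, 0, 0] (by decide) with e | e
    all_goals
      have e0 := e 0
      simp [al2, dl] at e0
      omega

lemma le_pairGroup : WB ⊓ MulAction.stabilizer PicAut Spair2 ≤ pairGroup := by
  rintro w ⟨hw, hstab⟩
  obtain ⟨u, hu, _, ⟨k, h, hh, rfl⟩, rfl⟩ := mem_cosetUnion_of_mem_WB hw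
  obtain ⟨hhW, hhS⟩ := pairGroup_le hh
  rw [← mul_assoc] at hw hstab
  have hW : u * trl ^ k ∈ WB := (Subgroup.mul_mem_cancel_right _ hhW).1 hw
  have hS := (Subgroup.mul_mem_cancel_right _ hhS).1 hstab
  rw [mem_stabilizer_Spair2_iff (act_dl_of_mem_WB hW), act_mul, act_trl_zpow_al2,
    act_add, act_zsmul, act_dl_of_mem_WB (cosetReps_subset_WB hu)] at hS
  obtain ⟨rfl, rfl⟩ := eq_of_act_al2_add hu hS
  simpa using hh

/-- The setwise stabilizer of `{α₂, δ-α₂}` in `W_B` is generated by `s₀`,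
`s₂s₁s₃s₂s₃s₁s₂`, `s₃`, `s₂s₁s₀s₂s₃s₂s₀s₁s₂` and `g = s₂s₁s₃s₀s₂`;
equivalently it equals `N ∪ N·g` where `N = {w ∈ W_B : w(α₂) = α₂}`. -/
theorem stmt11 :
    WB ⊓ MulAction.stabilizer PicAut Spair2 =
      Subgroup.closure {w0, a2e, sg3, b2e, ge} ∧
    ((WB ⊓ MulAction.stabilizer PicAut Spair2 : Subgroup PicAut) : Set PicAut) =
      ((WB ⊓ MulAction.stabilizer PicAut (al2 : Pic) : Subgroup PicAut) : Set PicAut) ∪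
        ((WB ⊓ MulAction.stabilizer PicAut (al2 : Pic) : Subgroup PicAut) : Set PicAut) *
          ({ge} : Set PicAut) := by
  refine ⟨le_antisymm le_pairGroup pairGroup_le, ?_⟩
  have hge : act ge al2 = dl - al2 := by decide +kernel
  ext w
  constructor
  · rintro ⟨hw, hS⟩
    rcases (mem_stabilizer_Spair2_iff (act_dl_of_mem_WB hw)).1 hS with e | e
    · exact Or.inl ⟨hw, e⟩
    · refine Or.inr (Set.mem_mul.2 ⟨w * ge, ⟨mul_mem hw ge_mem_WB, ?_⟩, ge, rfl, ?_⟩)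
      · refine mem_stabilizer_iff_act.2 ?_
        rw [act_mul, hge, act_sub, act_dl_of_mem_WB hw, e, sub_sub_cancel]
      · rw [mul_assoc, ge_mul_self, mul_one]
  · rintro (⟨hw, e⟩ | h)
    · exact ⟨hw, (mem_stabilizer_Spair2_iff (act_dl_of_mem_WB hw)).2 (Or.inl e)⟩
    · obtain ⟨x, ⟨hx, e⟩, _, rfl, rfl⟩ := Set.mem_mul.1 h
      have hxg : x * ge ∈ WB := mul_mem hx ge_mem_WB
      refine ⟨hxg, (mem_stabilizer_Spair2_iff (act_dl_of_mem_WB hxg)).2 (Or.inr ?_)⟩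
      rw [act_mul, hge, act_sub, act_dl_of_mem_WB hx, mem_stabilizer_iff_act.1 e]
end

section
/- Let G = {w ∈ Ŵ : w({α0+α1, α2+α3}) = {α0+α1, α2+α3}}. Then the subgroup H = {w ∈ G : w(α1+α2) = α1+α2} equals the subgroup of Ŵ generated by the three elements r_{γ0} = σ2∘w2∘w0, r_{γ1} = σ1∘σ2∘σ1∘w3∘w1, and σ1; moreover H is isomorphic to the free product ℤ/2 * ℤ/2 (the infinite dihedral group, i.e. the extended affine Weyl group of type A1^(1)). -/
open Pointwise

/-- The two-element set `{α₀+α₁, α₂+α₃} ⊆ Pic`. -/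
def Spair : Set Pic := {al0 + al1, al2 + al3}

/-- The setwise stabilizer `G` of `{α₀+α₁, α₂+α₃}` in `Ŵ`. -/
def G : Subgroup PicAut := Wh ⊓ MulAction.stabilizer PicAut Spair

/-- `H = {w ∈ G : w(α₁+α₂) = α₁+α₂}`. -/
def H : Subgroup PicAut := G ⊓ MulAction.stabilizer PicAut (al1 + al2 : Pic)

/-- The action of `Aut Pic` on `Pic` induced by the action of matrices on vectors; it agrees
definitionally with `act`. -/
instance picMulAction : MulAction PicAut Pic := Units.instMulAction

lemma inter_add_left (x y z : Pic) : inter (x + y) z = inter x z + inter y z := by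
  simp only [inter, Pi.add_apply]; ring

lemma inter_comm (x y : Pic) : inter x y = inter y x := by
  simp only [inter]; ring

lemma inter_add_right (x y z : Pic) : inter x (y + z) = inter x y + inter x z := by
  simp only [inter, Pi.add_apply]; ring

lemma inter_sub_left (x y z : Pic) : inter (x - y) z = inter x z - inter y z := by
  simp only [inter, Pi.sub_apply]; ring

lemma inter_smul_left (n : ℤ) (x y : Pic) : inter (n • x) y = n * inter x y := by
  simp only [inter, Pi.smul_apply, smul_eq_mul]; ring

lemma inter_smul_right (n : ℤ) (x y : Pic) : inter x (n • y) = n * inter x y := by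
  simp only [inter, Pi.smul_apply, smul_eq_mul]; ring

lemma reflMat_mulVec (a x : Pic) : (reflMat a).mulVec x = x + inter x a • a := by
  ext k
  have h : ∀ j, inter (bvec j) a * a k * x j = inter (x j • bvec j) a * a k := fun j => by
    rw [inter_smul_left]; ring
  simp only [reflMat, Matrix.mulVec, dotProduct, Matrix.of_apply, add_mul,
    Finset.sum_add_distrib, ite_mul, one_mul, zero_mul, Finset.sum_ite_eq, Finset.mem_univ,
    if_true, Pi.add_apply, Pi.smul_apply, smul_eq_mul, h, ← Finset.sum_mul]
  congr 2
  simp [Fin.sum_univ_succ, inter, bvec]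
  ring

lemma permMat_mulVec_bvec (p : Fin 10 → Fin 10) (j : Fin 10) :
    (permMat p).mulVec (bvec j) = bvec (p j) := by
  ext k
  simp [permMat, Matrix.mulVec, dotProduct, bvec, eq_comm]

/-- The root lattice spanned by the simple roots. -/
def rootLattice : AddSubgroup Pic := AddSubgroup.closure {al0, al1, al2, al3}

lemma al0_mem : al0 ∈ rootLattice := AddSubgroup.subset_closure (by simp)
lemma al1_mem : al1 ∈ rootLattice := AddSubgroup.subset_closure (by simp)
lemma al2_mem : al2 ∈ rootLattice := AddSubgroup.subset_closure (by simp)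
lemma al3_mem : al3 ∈ rootLattice := AddSubgroup.subset_closure (by simp)

lemma exists_coeff_of_mem_rootLattice {x : Pic} (hx : x ∈ rootLattice) :
    ∃ a b c d : ℤ, x = a • al0 + b • al1 + c • al2 + d • al3 := by
  induction hx using AddSubgroup.closure_induction with
  | mem x hx =>
    rcases hx with rfl | rfl | rfl | rfl
    · exact ⟨1, 0, 0, 0, by simp⟩
    · exact ⟨0, 1, 0, 0, by simp⟩
    · exact ⟨0, 0, 1, 0, by simp⟩
    · exact ⟨0, 0, 0, 1, by simp⟩
  | zero => exact ⟨0, 0, 0, 0, by simp⟩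
  | add x y _ _ hx hy =>
    obtain ⟨a, b, c, d, rfl⟩ := hx
    obtain ⟨a', b', c', d', rfl⟩ := hy
    exact ⟨a + a', b + b', c + c', d + d', by module⟩
  | neg x _ hx =>
    obtain ⟨a, b, c, d, rfl⟩ := hx
    exact ⟨-a, -b, -c, -d, by module⟩

lemma w0_smul (x : Pic) : w0 • x = x + inter x al0 • al0 := reflMat_mulVec _ _
lemma w1_smul (x : Pic) : w1 • x = x + inter x al1 • al1 := reflMat_mulVec _ _
lemma w2_smul (x : Pic) : w2 • x = x + inter x al2 • al2 := reflMat_mulVec _ _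
lemma w3_smul (x : Pic) : w3 • x = x + inter x al3 • al3 := reflMat_mulVec _ _

/-- The permutation of the basis of `Pic` induced by `σ₁`. -/
def sg1Perm : Fin 10 → Fin 10 := ![1, 0, 8, 9, 6, 7, 4, 5, 2, 3]

/-- The permutation of the basis of `Pic` induced by `σ₂`. -/
def sg2Perm : Fin 10 → Fin 10 := ![0, 1, 4, 5, 2, 3, 6, 7, 8, 9]

lemma sg1_val : sg1.val = permMat sg1Perm := by decide

lemma sg1_smul_bvec (j : Fin 10) : sg1 • bvec j = bvec (sg1Perm j) := by
  rw [smul_eq_act, act, sg1_val, permMat_mulVec_bvec]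

lemma sg2_smul_bvec (j : Fin 10) : sg2 • bvec j = bvec (sg2Perm j) :=
  permMat_mulVec_bvec _ _

lemma sg1_smul (x : Pic) : sg1 • x = x ∘ sg1Perm := by
  rw [smul_eq_act, act, sg1_val]
  ext k
  fin_cases k <;> simp [permMat, Matrix.mulVec, dotProduct, Fin.sum_univ_succ, sg1Perm]

lemma sg2_smul (x : Pic) : sg2 • x = x ∘ sg2Perm := by
  change (permMat sg2Perm).mulVec x = _
  ext k
  fin_cases k <;> simp [permMat, Matrix.mulVec, dotProduct, Fin.sum_univ_succ, sg2Perm]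

/-- The dihedral group of order eight generated by `sg1Perm` and `sg2Perm`. -/
def basisPerm : Fin 8 → Fin 10 → Fin 10 :=
  ![![0, 1, 2, 3, 4, 5, 6, 7, 8, 9],
    ![1, 0, 8, 9, 6, 7, 4, 5, 2, 3],
    ![0, 1, 4, 5, 2, 3, 6, 7, 8, 9],
    ![1, 0, 8, 9, 6, 7, 2, 3, 4, 5],
    ![1, 0, 6, 7, 8, 9, 4, 5, 2, 3],
    ![0, 1, 2, 3, 4, 5, 8, 9, 6, 7],
    ![1, 0, 6, 7, 8, 9, 2, 3, 4, 5],
    ![0, 1, 4, 5, 2, 3, 8, 9, 6, 7]]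

lemma exists_sg1Perm_basisPerm : ∀ i, ∃ i', ∀ j, sg1Perm (basisPerm i j) = basisPerm i' j := by
  decide

lemma exists_sg2Perm_basisPerm : ∀ i, ∃ i', ∀ j, sg2Perm (basisPerm i j) = basisPerm i' j := by
  decide

lemma inter_simple_roots :
    (inter al0 al0 = -2 ∧ inter al0 al1 = 1 ∧ inter al0 al2 = 0 ∧ inter al0 al3 = 1) ∧
    (inter al1 al0 = 1 ∧ inter al1 al1 = -2 ∧ inter al1 al2 = 1 ∧ inter al1 al3 = 0) ∧
    (inter al2 al0 = 0 ∧ inter al2 al1 = 1 ∧ inter al2 al2 = -2 ∧ inter al2 al3 = 1) ∧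
    (inter al3 al0 = 1 ∧ inter al3 al1 = 0 ∧ inter al3 al2 = 1 ∧ inter al3 al3 = -2) := by
  decide

lemma sg1_smul_simple_roots :
    sg1 • al0 = al3 ∧ sg1 • al1 = al2 ∧ sg1 • al2 = al1 ∧ sg1 • al3 = al0 := by
  simp only [sg1_smul]; decide

lemma sg2_smul_simple_roots :
    sg2 • al0 = al2 ∧ sg2 • al1 = al1 ∧ sg2 • al2 = al0 ∧ sg2 • al3 = al3 := by
  simp only [sg2_smul]; decide

/-- The elements of `Ŵ` are isometries preserving the root lattice, and they permute the
basis modulo the root lattice. -/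
structure IsRootIsometry (g : PicAut) : Prop where
  inter_smul : ∀ x y, inter (g • x) (g • y) = inter x y
  smul_mem : ∀ x ∈ rootLattice, g • x ∈ rootLattice
  exists_perm : ∃ i, ∀ j, g • bvec j - bvec (basisPerm i j) ∈ rootLattice

lemma IsRootIsometry.one : IsRootIsometry 1 where
  inter_smul x y := by simp
  smul_mem x hx := by simpa
  exists_perm := ⟨0, fun j => by
    have h : basisPerm 0 j = j := by revert j; decide
    simp [h]⟩

lemma IsRootIsometry.refl_mul {a : Pic} {w : PicAut} (hw : ∀ x : Pic, w • x = x + inter x a • a)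
    (ha : inter a a = -2) (hmem : a ∈ rootLattice) {g : PicAut} (hg : IsRootIsometry g) :
    IsRootIsometry (w * g) where
  inter_smul x y := by
    simp only [mul_smul, hw, inter_add_left, inter_add_right, inter_smul_left, inter_smul_right,
      ha, hg.inter_smul, inter_comm a]
    ring
  smul_mem x hx := by
    rw [mul_smul, hw]
    exact add_mem (hg.smul_mem x hx) (zsmul_mem hmem _)
  exists_perm := by
    obtain ⟨i, h⟩ := hg.exists_perm
    refine ⟨i, fun j => ?_⟩
    rw [mul_smul, hw, add_sub_right_comm]
    exact add_mem (h j) (zsmul_mem hmem _)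

lemma IsRootIsometry.perm_mul {p : Fin 10 → Fin 10} {s : PicAut}
    (hs : ∀ x : Pic, s • x = x ∘ p) (hsb : ∀ j, s • bvec j = bvec (p j))
    (hi : ∀ x y : Pic, inter (x ∘ p) (y ∘ p) = inter x y)
    (hr : ∀ a ∈ ({al0, al1, al2, al3} : Set Pic), s • a ∈ ({al0, al1, al2, al3} : Set Pic))
    (hp : ∀ i, ∃ i', ∀ j, p (basisPerm i j) = basisPerm i' j) {g : PicAut} (hg : IsRootIsometry g) :
    IsRootIsometry (s * g) := by
  have hQ : ∀ x ∈ rootLattice, s • x ∈ rootLattice := fun x hx => by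
    induction hx using AddSubgroup.closure_induction with
    | mem x hx => exact AddSubgroup.subset_closure (hr x hx)
    | zero => simp
    | add x y _ _ hx hy => rw [smul_add]; exact add_mem hx hy
    | neg x _ hx => rw [smul_neg]; exact neg_mem hx
  refine ⟨fun x y => ?_, fun x hx => ?_, ?_⟩
  · rw [mul_smul, mul_smul, hs, hs, hi, hg.inter_smul]
  · rw [mul_smul]
    exact hQ _ (hg.smul_mem x hx)
  · obtain ⟨i, h⟩ := hg.exists_perm
    obtain ⟨i', hi'⟩ := hp i
    refine ⟨i', fun j => ?_⟩
    rw [mul_smul, ← hi', ← hsb, ← smul_sub]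
    exact hQ _ (h j)

lemma IsRootIsometry.generator_mul {s : PicAut}
    (hs : s ∈ ({w0, w1, w2, w3, sg1, sg2} : Set PicAut)) {g : PicAut} (hg : IsRootIsometry g) :
    IsRootIsometry (s * g) := by
  rcases hs with rfl | rfl | rfl | rfl | rfl | rfl
  · exact hg.refl_mul w0_smul (by decide) al0_mem
  · exact hg.refl_mul w1_smul (by decide) al1_mem
  · exact hg.refl_mul w2_smul (by decide) al2_mem
  · exact hg.refl_mul w3_smul (by decide) al3_mem
  · refine hg.perm_mul sg1_smul sg1_smul_bvec (fun x y => ?_) ?_ ?_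
    · simp [inter, sg1Perm]; ring
    · obtain ⟨h0, h1, h2, h3⟩ := sg1_smul_simple_roots
      rintro a (rfl | rfl | rfl | rfl) <;> simp [h0, h1, h2, h3]
    · exact exists_sg1Perm_basisPerm
  · refine hg.perm_mul sg2_smul sg2_smul_bvec (fun x y => ?_) ?_ ?_
    · simp [inter, sg2Perm]; ring
    · obtain ⟨h0, h1, h2, h3⟩ := sg2_smul_simple_roots
      rintro a (rfl | rfl | rfl | rfl) <;> simp [h0, h1, h2, h3]
    · exact exists_sg2Perm_basisPerm

lemma inv_eq_self_of_generator {s : PicAut}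
    (hs : s ∈ ({w0, w1, w2, w3, sg1, sg2} : Set PicAut)) : s⁻¹ = s := by
  rcases hs with rfl | rfl | rfl | rfl | rfl | rfl <;> rfl

lemma isRootIsometry_of_mem_Wh {g : PicAut} (hg : g ∈ Wh) : IsRootIsometry g := by
  induction hg using Subgroup.closure_induction_left with
  | one => exact .one
  | mul_left s hs g _ h => exact h.generator_mul hs
  | inv_mul_cancel s hs g _ h =>
    rw [inv_eq_self_of_generator hs]
    exact h.generator_mul hs

/-- A character of `Pic` modulo the root lattice, with values in `ℤ / 4`. -/
def rootChar (x : Pic) : ZMod 4 := (inter x al1 + 2 * inter x al2 + 3 * inter x al3 : ℤ)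

lemma rootChar_sub (x y : Pic) : rootChar (x - y) = rootChar x - rootChar y := by
  simp only [rootChar, inter_sub_left]; push_cast; ring

lemma rootChar_eq_zero {x : Pic} (hx : x ∈ rootLattice) : rootChar x = 0 := by
  obtain ⟨a, b, c, d, rfl⟩ := exists_coeff_of_mem_rootLattice hx
  simp only [rootChar, inter_add_left, inter_smul_left, inter_simple_roots]
  rw [ZMod.intCast_zmod_eq_zero_iff_dvd]
  exact ⟨a - d, by push_cast; ring⟩

lemma basisPerm_eq_of_rootChar_bvec :
    ∀ i, (∀ j, rootChar (bvec (basisPerm i j)) = rootChar (bvec j)) → ∀ j, basisPerm i j = j := by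
  decide

lemma eq_one_of_smul_bvec {g : PicAut} (h : ∀ j, g • bvec j = bvec j) : g = 1 := by
  ext i j
  have := congrFun (h j) i
  simpa [smul_eq_act, act, Matrix.mulVec, dotProduct, bvec, Matrix.one_apply] using this

/-- `Ŵ` acts faithfully on the root lattice. -/
lemma eq_one_of_smul_simple_roots {g : PicAut} (hg : g ∈ Wh) (h0 : g • al0 = al0)
    (h1 : g • al1 = al1) (h2 : g • al2 = al2) (h3 : g • al3 = al3) : g = 1 := by
  obtain ⟨hi, -, i, hb⟩ := isRootIsometry_of_mem_Wh hg
  have i0 (x) : inter (g • x) al0 = inter x al0 := by simpa [h0] using hi x al0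
  have i1 (x) : inter (g • x) al1 = inter x al1 := by simpa [h1] using hi x al1
  have i2 (x) : inter (g • x) al2 = inter x al2 := by simpa [h2] using hi x al2
  have i3 (x) : inter (g • x) al3 = inter x al3 := by simpa [h3] using hi x al3
  have hpj : ∀ j, rootChar (bvec (basisPerm i j)) = rootChar (bvec j) := fun j => by
    have := rootChar_eq_zero (hb j)
    rw [rootChar_sub, sub_eq_zero] at this
    rw [← this, rootChar, rootChar, i1, i2, i3]
  refine eq_one_of_smul_bvec fun j => ?_
  obtain ⟨a, b, c, d, hj⟩ := exists_coeff_of_mem_rootLattice (hb j)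
  rw [basisPerm_eq_of_rootChar_bvec i hpj] at hj
  have e0 : inter (g • bvec j - bvec j) al0 = 0 := by rw [inter_sub_left, i0, sub_self]
  have e1 : inter (g • bvec j - bvec j) al1 = 0 := by rw [inter_sub_left, i1, sub_self]
  have e2 : inter (g • bvec j - bvec j) al2 = 0 := by rw [inter_sub_left, i2, sub_self]
  have e3 : inter (g • bvec j - bvec j) al3 = 0 := by rw [inter_sub_left, i3, sub_self]
  simp only [hj, inter_add_left, inter_smul_left, inter_simple_roots] at e0 e1 e2 e3
  obtain rfl : b = a := by lia
  obtain rfl : c = b := by lia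
  obtain rfl : d = c := by lia
  have hδ : al0 + al1 + al2 + al3 = dl := by decide
  rw [← smul_add, ← smul_add, ← smul_add, hδ, sub_eq_iff_eq_add'] at hj
  have hsq := hi (bvec j) (bvec j)
  have hδδ : inter dl dl = 0 := by decide
  rw [hj] at hsq ⊢
  simp only [inter_add_left, inter_add_right, inter_smul_left, inter_smul_right, hδδ,
    inter_comm dl] at hsq
  have hne : ∀ j, inter (bvec j) dl ≠ 0 := by decide
  have hd : d * inter (bvec j) dl = 0 := by lia
  rw [(mul_eq_zero.1 hd).resolve_right (hne j)]
  simp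

lemma w0_mem : w0 ∈ Wh := Subgroup.subset_closure (by simp)
lemma w1_mem : w1 ∈ Wh := Subgroup.subset_closure (by simp)
lemma w2_mem : w2 ∈ Wh := Subgroup.subset_closure (by simp)
lemma w3_mem : w3 ∈ Wh := Subgroup.subset_closure (by simp)
lemma sg1_mem : sg1 ∈ Wh := Subgroup.subset_closure (by simp)
lemma sg2_mem : sg2 ∈ Wh := Subgroup.subset_closure (by simp)

/-- The reflection `r_γ₀`. -/
def rg0 : PicAut := sg2 * w2 * w0

/-- The reflection `r_γ₁`. -/
def rg1 : PicAut := sg1 * sg2 * sg1 * w3 * w1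

lemma rg0_mem : rg0 ∈ Wh := mul_mem (mul_mem sg2_mem w2_mem) w0_mem

lemma rg1_mem : rg1 ∈ Wh :=
  mul_mem (mul_mem (mul_mem (mul_mem sg1_mem sg2_mem) sg1_mem) w3_mem) w1_mem

lemma rg0_smul_simple_roots :
    rg0 • al0 = -al2 ∧ rg0 • al1 = al0 + al1 + al2 ∧ rg0 • al2 = -al0 ∧
      rg0 • al3 = al0 + al2 + al3 := by
  simp only [rg0, mul_smul, w0_smul, w2_smul, inter_smul_left,
    inter_simple_roots, smul_add, sg2_smul_simple_roots, smul_comm sg2 (_ : ℤ)]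
  decide

lemma rg1_smul_simple_roots :
    rg1 • al0 = al0 + al1 + al3 ∧ rg1 • al1 = -al3 ∧ rg1 • al2 = al1 + al2 + al3 ∧
      rg1 • al3 = -al1 := by
  simp only [rg1, mul_smul, w1_smul, w3_smul, inter_smul_left,
    inter_simple_roots, smul_add, sg1_smul_simple_roots, sg2_smul_simple_roots,
    smul_comm sg1 (_ : ℤ), smul_comm sg2 (_ : ℤ)]
  decide

lemma sg1_mul_sg1 : sg1 * sg1 = 1 := mul_inv_cancel sg1

lemma rg0_mul_rg0 : rg0 * rg0 = 1 := by
  obtain ⟨h0, h1, h2, h3⟩ := rg0_smul_simple_roots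
  apply eq_one_of_smul_simple_roots (mul_mem rg0_mem rg0_mem) <;>
    simp only [mul_smul, h0, h1, h2, h3, smul_add, smul_neg] <;> abel

lemma rg1_eq : rg1 = sg1 * rg0 * sg1 := by
  obtain ⟨h0, h1, h2, h3⟩ := rg0_smul_simple_roots
  obtain ⟨k0, k1, k2, k3⟩ := rg1_smul_simple_roots
  obtain ⟨s0, s1, s2, s3⟩ := sg1_smul_simple_roots
  have h : sg1 * rg0 * sg1 * rg1 = 1 := by
    apply eq_one_of_smul_simple_roots
      (mul_mem (mul_mem (mul_mem sg1_mem rg0_mem) sg1_mem) rg1_mem) <;>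
    simp only [mul_smul, h0, h1, h2, h3, k0, k1, k2, k3, s0, s1, s2, s3, smul_add, smul_neg] <;>
    abel
  calc rg1 = sg1 * (rg0 * (sg1 * sg1) * rg0) * sg1 * rg1 := by
        simp [sg1_mul_sg1, rg0_mul_rg0]
    _ = sg1 * rg0 * sg1 * (sg1 * rg0 * sg1 * rg1) := by simp only [mul_assoc]
    _ = sg1 * rg0 * sg1 := by rw [h, mul_one]

lemma mem_H_iff {g : PicAut} : g ∈ H ↔ g ∈ Wh ∧
    (g • (al0 + al1) = al0 + al1 ∧ g • (al2 + al3) = al2 + al3 ∨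
      g • (al0 + al1) = al2 + al3 ∧ g • (al2 + al3) = al0 + al1) ∧
    g • (al1 + al2) = al1 + al2 := by
  have hS : g ∈ MulAction.stabilizer PicAut Spair ↔
      ({g • (al0 + al1), g • (al2 + al3)} : Set Pic) = {al0 + al1, al2 + al3} :=
    Eq.congr_left (Set.image_pair (g • · : Pic → Pic) _ _)
  rw [Set.pair_eq_pair_iff] at hS
  rw [← hS, ← and_assoc]
  rfl

lemma sg1_mem_H : sg1 ∈ H := by
  obtain ⟨h0, h1, h2, h3⟩ := sg1_smul_simple_roots
  refine mem_H_iff.2 ⟨sg1_mem, .inr ⟨?_, ?_⟩, ?_⟩ <;>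
    simp only [smul_add, h0, h1, h2, h3] <;> abel

lemma rg0_mem_H : rg0 ∈ H := by
  obtain ⟨h0, h1, h2, h3⟩ := rg0_smul_simple_roots
  refine mem_H_iff.2 ⟨rg0_mem, .inl ⟨?_, ?_⟩, ?_⟩ <;>
    simp only [smul_add, h0, h1, h2, h3] <;> abel

lemma rg0_mul_sg1_smul :
    (rg0 * sg1) • (al1 + al3) = (al1 + al3) - dl ∧ (rg0 * sg1) • dl = dl := by
  obtain ⟨h0, h1, h2, h3⟩ := rg0_smul_simple_roots
  obtain ⟨s0, s1, s2, s3⟩ := sg1_smul_simple_roots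
  have hδ : dl = al0 + al1 + al2 + al3 := by decide
  simp only [hδ, mul_smul, smul_add, h0, h1, h2, h3, s0, s1, s2, s3]
  constructor <;> abel

lemma zpow_smul_dl (n : ℤ) : (rg0 * sg1) ^ n • dl = dl := by
  have h : rg0 * sg1 ∈ MulAction.stabilizer PicAut dl := rg0_mul_sg1_smul.2
  exact zpow_mem h n

lemma zpow_smul_line (n : ℤ) : (rg0 * sg1) ^ n • (al1 + al3) = (al1 + al3) - n • dl := by
  induction n using Int.induction_on with
  | zero => simp
  | succ n ih =>
    rw [zpow_add_one, mul_smul, rg0_mul_sg1_smul.1, smul_sub, ih, zpow_smul_dl]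
    module
  | pred n ih =>
    have h : (rg0 * sg1)⁻¹ • (al1 + al3) = (al1 + al3) + dl := by
      rw [inv_smul_eq_iff, smul_add, rg0_mul_sg1_smul.1, rg0_mul_sg1_smul.2]
      abel
    rw [zpow_sub_one, mul_smul, h, smul_add, ih, zpow_smul_dl]
    module

lemma sg1_smul_line : sg1 • (al1 + al3) = dl - (al1 + al3) := by
  obtain ⟨s0, s1, s2, s3⟩ := sg1_smul_simple_roots
  rw [smul_add, s1, s3]
  decide

lemma sg1_smul_dl : sg1 • dl = dl := by rw [sg1_smul]; decide

/-- An element of `H` acts on the line orthogonal to the fixed roots by a translation or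
a reflection. -/
lemma exists_smul_line {g : PicAut} (hg : g ∈ H) :
    ∃ k : ℤ, g • (al1 + al3) = (al1 + al3) + k • dl ∨
      g • (al1 + al3) = -(al1 + al3) + k • dl := by
  obtain ⟨hW, hS, hγ⟩ := mem_H_iff.1 hg
  obtain ⟨hi, hQ, -⟩ := isRootIsometry_of_mem_Wh hW
  have eγ := hi (al1 + al3) (al1 + al2)
  have eβ := hi (al1 + al3) (al0 + al1)
  have el := hi (al1 + al3) (al1 + al3)
  rw [hγ] at eγ
  obtain ⟨a, b, c, d, h⟩ := exists_coeff_of_mem_rootLattice (hQ _ (add_mem al1_mem al3_mem))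
  have hδ : dl = al0 + al1 + al2 + al3 := by decide
  rw [h] at eγ eβ el ⊢
  simp only [inter_add_left, inter_add_right, inter_smul_left, inter_smul_right,
    inter_simple_roots] at eγ el
  have eβ' : a + b = c + d := by
    rcases hS with ⟨h, -⟩ | ⟨h, -⟩ <;> rw [h] at eβ <;>
      simp only [inter_add_left, inter_add_right, inter_smul_left, inter_simple_roots] at eβ <;> lia
  obtain rfl : c = a := by lia
  obtain rfl : d = b := by lia
  have hsq : (d - c) * (d - c) = 1 := by linarith
  refine ⟨c, ?_⟩
  rcases mul_self_eq_one_iff.1 hsq with h | h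
  · obtain rfl : d = c + 1 := by lia
    left; rw [hδ]; module
  · obtain rfl : d = c - 1 := by lia
    right; rw [hδ]; module

lemma eq_one_of_smul_line {g : PicAut} (hg : g ∈ H) (hl : g • (al1 + al3) = al1 + al3) :
    g = 1 := by
  obtain ⟨hW, hS, hγ⟩ := mem_H_iff.1 hg
  rcases hS with ⟨h, h'⟩ | ⟨h, h'⟩
  · have two_al1 : (2 : ℤ) • (g • al1) = (2 : ℤ) • al1 := by
      have : (2 : ℤ) • al1 = (al1 + al3) + (al1 + al2) - (al2 + al3) := by module
      rw [← smul_comm, this, smul_sub, smul_add, hl, hγ, h']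
    have h1 : g • al1 = al1 := smul_right_injective Pic (two_ne_zero : (2 : ℤ) ≠ 0) two_al1
    rw [smul_add, h1] at hl hγ h
    exact eq_one_of_smul_simple_roots hW (add_right_cancel h) h1 (add_left_cancel hγ)
      (add_left_cancel hl)
  · have two_al1 : (2 : ℤ) • (g • al1) = (al1 + al3) + (al1 + al2) - (al0 + al1) := by
      have : (2 : ℤ) • al1 = (al1 + al3) + (al1 + al2) - (al2 + al3) := by module
      rw [← smul_comm, this, smul_sub, smul_add, hl, hγ, h']
    have h2 := congrFun two_al1 2
    have h3 : ((al1 + al3) + (al1 + al2) - (al0 + al1) : Pic) 2 = 1 := by decide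
    rw [h3, Pi.smul_apply, smul_eq_mul] at h2
    lia

lemma mem_closure_of_smul_line {g : PicAut} (hg : g ∈ H) {k : ℤ}
    (hl : g • (al1 + al3) = (al1 + al3) + k • dl) : g ∈ Subgroup.closure {rg0, sg1} := by
  have hT : (rg0 * sg1) ^ k ∈ H := zpow_mem (mul_mem rg0_mem_H sg1_mem_H) k
  have h1 : (rg0 * sg1) ^ k * g = 1 := by
    refine eq_one_of_smul_line (mul_mem hT hg) ?_
    rw [mul_smul, hl, smul_add, zpow_smul_line, smul_comm, zpow_smul_dl, sub_add_cancel]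
  rw [eq_inv_of_mul_eq_one_right h1]
  exact inv_mem (zpow_mem (mul_mem (Subgroup.subset_closure (by simp))
    (Subgroup.subset_closure (by simp))) k)

lemma H_eq_closure_pair : H = Subgroup.closure {rg0, sg1} := by
  refine le_antisymm (fun g hg => ?_) ?_
  · obtain ⟨k, hk | hk⟩ := exists_smul_line hg
    · exact mem_closure_of_smul_line hg hk
    · have h : sg1 * g ∈ Subgroup.closure {rg0, sg1} := by
        refine mem_closure_of_smul_line (k := k - 1) (mul_mem sg1_mem_H hg) ?_
        rw [mul_smul, hk, smul_add, smul_neg, sg1_smul_line, smul_comm, sg1_smul_dl]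
        module
      exact (Subgroup.mul_mem_cancel_left _ (Subgroup.subset_closure (by simp))).1 h
  · rw [Subgroup.closure_le]
    rintro g (rfl | rfl)
    exacts [rg0_mem_H, sg1_mem_H]

/-- The homomorphism `ℤ/2 → M` determined by an element whose square is `1`. -/
def zmodTwoHom {M : Type*} [Monoid M] (a : M) (ha : a * a = 1) :
    Multiplicative (ZMod 2) →* M where
  toFun x := a ^ x.toAdd.val
  map_one' := by simp
  map_mul' x y := by
    rw [← pow_add, toAdd_mul, ZMod.val_add, ← pow_eq_pow_mod _ (by rw [pow_two, ha])]

lemma zmodTwoHom_apply_ofAdd_one {M : Type*} [Monoid M] (a : M) (ha : a * a = 1) :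
    zmodTwoHom a ha (Multiplicative.ofAdd 1) = a :=
  pow_one a

lemma eq_one_or_eq_ofAdd_one (x : Multiplicative (ZMod 2)) :
    x = 1 ∨ x = Multiplicative.ofAdd 1 := by
  revert x
  decide

/-- In a group generated by two involutions `a`, `b`, every element is `(ab)ⁿ` or `(ab)ⁿb`. -/
lemma exists_zpow_of_mem_closure_pair {M : Type*} [Group M] {a b : M} (ha : a * a = 1)
    (hb : b * b = 1) {x : M} (hx : x ∈ Subgroup.closure {a, b}) :
    ∃ n : ℤ, x = (a * b) ^ n ∨ x = (a * b) ^ n * b := by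
  have hright : ∀ y ∈ ({a, b} : Set M), ∀ x, (∃ n : ℤ, x = (a * b) ^ n ∨ x = (a * b) ^ n * b) →
      ∃ n : ℤ, x * y = (a * b) ^ n ∨ x * y = (a * b) ^ n * b := by
    rintro y (rfl | rfl) x ⟨n, rfl | rfl⟩
    · exact ⟨n + 1, .inr (by rw [zpow_add_one, mul_assoc, mul_assoc, hb, mul_one])⟩
    · refine ⟨n - 1, .inl ?_⟩
      rw [zpow_sub_one, mul_inv_rev, ← eq_inv_of_mul_eq_one_left ha,
        ← eq_inv_of_mul_eq_one_left hb, mul_assoc]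
    · exact ⟨n, .inr rfl⟩
    · exact ⟨n, .inl (by rw [mul_assoc, hb, mul_one])⟩
  induction hx using Subgroup.closure_induction_right with
  | one => exact ⟨0, .inl (by simp)⟩
  | mul_right x _ y hy h => exact hright y hy x h
  | mul_inv_cancel x _ y hy h =>
    have : y⁻¹ = y := by
      rcases hy with rfl | rfl
      exacts [(eq_inv_of_mul_eq_one_left ha).symm, (eq_inv_of_mul_eq_one_left hb).symm]
    rw [this]
    exact hright y hy x h

open Monoid.Coprod in
lemma coprod_closure_pair :
    Subgroup.closure {(inl (Multiplicative.ofAdd 1) :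
      Monoid.Coprod (Multiplicative (ZMod 2)) (Multiplicative (ZMod 2))),
      inr (Multiplicative.ofAdd 1)} = ⊤ := by
  refine eq_top_iff.2 fun x _ => ?_
  induction x using Monoid.Coprod.induction_on with
  | inl m =>
    rcases eq_one_or_eq_ofAdd_one m with rfl | rfl
    · simp
    · exact Subgroup.subset_closure (by simp)
  | inr m =>
    rcases eq_one_or_eq_ofAdd_one m with rfl | rfl
    · simp
    · exact Subgroup.subset_closure (by simp)
  | mul x y hx hy => exact mul_mem (hx trivial) (hy trivial)

/-- The homomorphism `ℤ/2 * ℤ/2 → Aut Pic` given by `r_γ₀` and `σ₁`. -/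
def coprodHom : Monoid.Coprod (Multiplicative (ZMod 2)) (Multiplicative (ZMod 2)) →* PicAut :=
  Monoid.Coprod.lift (zmodTwoHom rg0 rg0_mul_rg0) (zmodTwoHom sg1 sg1_mul_sg1)

lemma coprodHom_inl : coprodHom (Monoid.Coprod.inl (Multiplicative.ofAdd 1)) = rg0 := by
  rw [coprodHom, Monoid.Coprod.lift_apply_inl, zmodTwoHom_apply_ofAdd_one]

lemma coprodHom_inr : coprodHom (Monoid.Coprod.inr (Multiplicative.ofAdd 1)) = sg1 := by
  rw [coprodHom, Monoid.Coprod.lift_apply_inr, zmodTwoHom_apply_ofAdd_one]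

lemma coprodHom_range : coprodHom.range = H := by
  rw [MonoidHom.range_eq_map, ← coprod_closure_pair, MonoidHom.map_closure, Set.image_pair,
    coprodHom_inl, coprodHom_inr, H_eq_closure_pair]

lemma coprodHom_injective : Function.Injective coprodHom := by
  rw [injective_iff_map_eq_one]
  intro x hx
  have hsq : (Multiplicative.ofAdd 1 : Multiplicative (ZMod 2)) * Multiplicative.ofAdd 1 = 1 := by
    decide
  have hmem : x ∈ Subgroup.closure _ := coprod_closure_pair ▸ Subgroup.mem_top x
  obtain ⟨n, rfl | rfl⟩ := exists_zpow_of_mem_closure_pair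
    (by rw [← map_mul, hsq, map_one]) (by rw [← map_mul, hsq, map_one]) hmem
  · rw [map_zpow, map_mul, coprodHom_inl, coprodHom_inr] at hx
    have h := zpow_smul_line n
    rw [hx, one_smul] at h
    have h2 := congrFun h 2
    simp [dl] at h2
    simp [h2]
  · rw [map_mul, map_zpow, map_mul, coprodHom_inl, coprodHom_inr] at hx
    have h : ((rg0 * sg1) ^ n * sg1) • (al1 + al3) = al1 + al3 := by rw [hx, one_smul]
    rw [mul_smul, sg1_smul_line, smul_sub, zpow_smul_dl, zpow_smul_line] at h
    have h0 := congrFun h 0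
    have h2 := congrFun h 2
    simp [dl, al1, al3] at h0 h2
    lia

/-- `H` is generated by `r_γ₀ = σ₂w₂w₀`, `r_γ₁ = σ₁σ₂σ₁w₃w₁`, and `σ₁`, and it is
isomorphic to the free product `ℤ/2 * ℤ/2` (the infinite dihedral group). -/
theorem stmt14 :
    H = Subgroup.closure {sg2 * w2 * w0, sg1 * sg2 * sg1 * w3 * w1, sg1} ∧
    Nonempty (H ≃* Monoid.Coprod (Multiplicative (ZMod 2)) (Multiplicative (ZMod 2))) := by
  change H = Subgroup.closure {rg0, rg1, sg1} ∧ _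
  refine ⟨le_antisymm ?_ ?_, ⟨?_⟩⟩
  · rw [H_eq_closure_pair]
    exact Subgroup.closure_mono (by simp [Set.insert_subset_iff])
  · rw [Subgroup.closure_le]
    rintro g (rfl | rfl | rfl)
    · exact rg0_mem_H
    · rw [rg1_eq]
      exact mul_mem (mul_mem sg1_mem_H rg0_mem_H) sg1_mem_H
    · exact sg1_mem_H
  · exact ((MonoidHom.ofInjective coprodHom_injective).trans
      (MulEquiv.subgroupCongr coprodHom_range)).symm
end

section
/- The only element of the subgroup ⟨w0∘w3∘w0, w1∘w2∘w1, (σ1∘σ2)²⟩ of Ŵ that fixes the vector α1 + α2 ∈ Pic is the identity. -/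
open Pointwise

/-- In a group where `s` and `t` are involutions, every element of the subgroup generated by
`t * s * t`, `s` and `t` is a power of `t * s` or such a power times `s`. -/
lemma exists_zpow_of_mem_closure_involutions {G : Type*} [Group G] {s t g : G}
    (hs : s * s = 1) (ht : t * t = 1) (hg : g ∈ Subgroup.closure {t * s * t, s, t}) :
    ∃ n : ℤ, g = (t * s) ^ n ∨ g = (t * s) ^ n * s := by
  have s_inv : s⁻¹ = s := inv_eq_of_mul_eq_one_left hs
  have t_inv : t⁻¹ = t := inv_eq_of_mul_eq_one_left ht
  have conj (n : ℤ) : s * (t * s) ^ n = (t * s) ^ (-n) * s := by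
    have base : SemiconjBy s (t * s) (t * s)⁻¹ := by
      simp [SemiconjBy, mul_assoc, s_inv, t_inv]
    simpa only [inv_zpow'] using (base.zpow_right n).eq
  induction hg using Subgroup.closure_induction with
  | mem x hx =>
    rcases hx with rfl | rfl | rfl
    · exact ⟨2, Or.inr (by rw [zpow_two]; simp only [mul_assoc, hs, mul_one])⟩
    · exact ⟨0, Or.inr (by simp)⟩
    · exact ⟨1, Or.inr (by simp [mul_assoc, hs])⟩
  | one => exact ⟨0, Or.inl (by simp)⟩
  | mul x y _ _ hx hy =>
    obtain ⟨m, rfl | rfl⟩ := hx <;> obtain ⟨n, rfl | rfl⟩ := hy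
    · exact ⟨m + n, Or.inl (zpow_add _ _ _).symm⟩
    · exact ⟨m + n, Or.inr (by rw [zpow_add, mul_assoc])⟩
    · exact ⟨m + -n, Or.inr (by rw [zpow_add, mul_assoc, conj, mul_assoc])⟩
    · refine ⟨m + -n, Or.inl ?_⟩
      rw [mul_assoc, ← mul_assoc s, conj, mul_assoc _ s s, hs, mul_one, zpow_add]
  | inv x _ hx =>
    obtain ⟨n, rfl | rfl⟩ := hx
    · exact ⟨-n, Or.inl (zpow_neg _ _).symm⟩
    · exact ⟨n, Or.inr (by rw [mul_inv_rev, s_inv, ← zpow_neg, conj, neg_neg])⟩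

lemma permMat_mul_permMat (p q : Fin 10 → Fin 10) :
    permMat p * permMat q = permMat (p ∘ q) := by
  ext i j
  simp [permMat, Matrix.mul_apply]

lemma mkAut_mul_self (M : Matrix (Fin 10) (Fin 10) ℤ) (h : M * M = 1) :
    mkAut M h * mkAut M h = 1 :=
  Units.ext h

/-- `σ₁σ₂` permutes the basis of `Pic`. -/
lemma val_sg1_mul_sg2 : (sg1 * sg2).val = permMat ![1, 0, 6, 7, 8, 9, 4, 5, 2, 3] := by
  have h : sg1.val = permMat ![1, 0, 8, 9, 6, 7, 4, 5, 2, 3] := by decide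
  rw [Units.val_mul, h, show sg2.val = permMat ![0, 1, 4, 5, 2, 3, 6, 7, 8, 9] from rfl,
    permMat_mul_permMat]
  congr 1
  decide

lemma val_sg1_mul_sg2_sq :
    ((sg1 * sg2) ^ 2).val = permMat ![0, 1, 4, 5, 2, 3, 8, 9, 6, 7] := by
  rw [pow_two, Units.val_mul, val_sg1_mul_sg2, permMat_mul_permMat]
  congr 1
  decide

lemma sg1_mul_sg2_sq_mul_self : (sg1 * sg2) ^ 2 * (sg1 * sg2) ^ 2 = 1 := by
  apply Units.ext
  rw [Units.val_mul, val_sg1_mul_sg2_sq]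
  decide

lemma sg1_mul_sg2_sq_mul_w1 : (sg1 * sg2) ^ 2 * w1 = w3 * (sg1 * sg2) ^ 2 := by
  apply Units.ext
  rw [Units.val_mul, Units.val_mul, val_sg1_mul_sg2_sq]
  decide

lemma sg1_mul_sg2_sq_mul_w2 : (sg1 * sg2) ^ 2 * w2 = w0 * (sg1 * sg2) ^ 2 := by
  apply Units.ext
  rw [Units.val_mul, Units.val_mul, val_sg1_mul_sg2_sq]
  decide

/-- The braid relation between `w₀` and `w₃`. -/
lemma w0_mul_w3_mul_w0 : w0 * w3 * w0 = w3 * w0 * w3 := by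
  have h : (w0 * w3 * w0).val = reflMat (al0 + al3) := by decide
  have h' : (w3 * w0 * w3).val = reflMat (al0 + al3) := by decide
  exact Units.ext (h.trans h'.symm)

lemma w1_mul_w2_mul_w1_mul_self : w1 * w2 * w1 * (w1 * w2 * w1) = 1 := by
  have h1 : w1 * w1 = 1 := mkAut_mul_self _ _
  have h2 : w2 * w2 = 1 := mkAut_mul_self _ _
  rw [mul_assoc, ← mul_assoc w1 (w1 * w2), ← mul_assoc w1 w1, h1, one_mul, mul_assoc,
    ← mul_assoc w2, h2, one_mul, h1]

lemma sg1_mul_sg2_sq_conj :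
    (sg1 * sg2) ^ 2 * (w1 * w2 * w1) * (sg1 * sg2) ^ 2 = w0 * w3 * w0 := by
  have h1 := sg1_mul_sg2_sq_mul_w1
  have h2 := sg1_mul_sg2_sq_mul_w2
  have ht := sg1_mul_sg2_sq_mul_self
  generalize (sg1 * sg2) ^ 2 = t at *
  calc t * (w1 * w2 * w1) * t = t * w1 * w2 * w1 * t := by simp only [mul_assoc]
    _ = w3 * (t * w2) * w1 * t := by rw [h1]; simp only [mul_assoc]
    _ = w3 * w0 * (t * w1) * t := by rw [h2]; simp only [mul_assoc]
    _ = w3 * w0 * w3 * (t * t) := by rw [h1]; simp only [mul_assoc]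
    _ = w0 * w3 * w0 := by rw [ht, mul_one, w0_mul_w3_mul_w0]

lemma val_w1_mul_w2_mul_w1 : (w1 * w2 * w1).val = reflMat (al1 + al2) := by
  decide

lemma act_w1_mul_w2_mul_w1 : act (w1 * w2 * w1) (al1 + al2) = -(al1 + al2) := by
  rw [act, val_w1_mul_w2_mul_w1]
  decide

/-- `(σ₁σ₂)² ∘ w₁w₂w₁` translates `α₁ + α₂` by `-δ`, and its powers by multiples of `-δ`. -/
lemma act_zpow_al1_add_al2 (n : ℤ) :
    act (((sg1 * sg2) ^ 2 * (w1 * w2 * w1)) ^ n) (al1 + al2) = al1 + al2 - n • dl := by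
  have act_sub (g : PicAut) (v w : Pic) : act g (v - w) = act g v - act g w :=
    Matrix.mulVec_sub _ _ _
  have val_eq : ((sg1 * sg2) ^ 2 * (w1 * w2 * w1)).val =
      permMat ![0, 1, 4, 5, 2, 3, 8, 9, 6, 7] * reflMat (al1 + al2) := by
    rw [Units.val_mul, val_sg1_mul_sg2_sq, val_w1_mul_w2_mul_w1]
  have act_dl : act ((sg1 * sg2) ^ 2 * (w1 * w2 * w1)) dl = dl := by
    rw [act, val_eq]
    decide
  have act_base : act ((sg1 * sg2) ^ 2 * (w1 * w2 * w1)) (al1 + al2) = al1 + al2 - dl := by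
    rw [act, val_eq]
    decide
  generalize (sg1 * sg2) ^ 2 * (w1 * w2 * w1) = p at *
  have act_zpow_dl (k : ℤ) : act (p ^ k) dl = dl :=
    zpow_mem (show p ∈ MulAction.stabilizer PicAut dl from act_dl) k
  have act_zpow_succ (k : ℤ) : act (p ^ (k + 1)) (al1 + al2) = act (p ^ k) (al1 + al2) - dl := by
    rw [zpow_add_one, act_mul, act_base, act_sub, act_zpow_dl]
  induction n using Int.induction_on with
  | zero => simp [act]
  | succ k ih => rw [act_zpow_succ, ih, add_smul, one_smul]; abel
  | pred k ih =>
    have h := act_zpow_succ (-(k : ℤ) - 1)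
    rw [sub_add_cancel, ih] at h
    rw [sub_smul, one_smul, eq_add_of_sub_eq h.symm]
    abel

/-- The only element of `⟨w₀w₃w₀, w₁w₂w₁, (σ₁σ₂)²⟩` fixing `α₁ + α₂` is the
identity. -/
theorem stmt15 :
    ∀ g ∈ Subgroup.closure {w0 * w3 * w0, w1 * w2 * w1, (sg1 * sg2) ^ 2},
      act g (al1 + al2) = al1 + al2 → g = 1 := by
  intro g hg hfix
  rw [← sg1_mul_sg2_sq_conj] at hg
  obtain ⟨n, rfl | rfl⟩ := exists_zpow_of_mem_closure_involutions
    w1_mul_w2_mul_w1_mul_self sg1_mul_sg2_sq_mul_self hg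
  · rw [act_zpow_al1_add_al2] at hfix
    have h := congrFun hfix 2
    simp [al1, al2, dl] at h
    simp [h]
  · rw [act_mul, act_w1_mul_w2_mul_w1] at hfix
    have act_neg (g : PicAut) (v : Pic) : act g (-v) = -act g v := Matrix.mulVec_neg _ _
    rw [act_neg, act_zpow_al1_add_al2] at hfix
    have h2 := congrFun hfix 2
    have h4 := congrFun hfix 4
    simp [al1, al2, dl] at h2 h4
    omega
end

section
/- The translations ψ_* = σ1∘σ2∘σ1∘σ2∘w3∘w1∘w2∘w0 and η_* = σ1∘σ2∘w2∘w1∘w0 are not conjugate in Ŵ: for every w ∈ Ŵ, w∘ψ_*∘w⁻¹ ≠ η_*. (ψ_* corresponds to the translation by the weight h1 − h2 + h3 of squared length 1 and η_* to the translation by h3 of squared length 3/4, and elements of Ŵ preserve the intersection form and δ.) -/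
open Pointwise

/-- `ψ⁎ = σ₁σ₂σ₁σ₂w₃w₁w₂w₀`. -/
def psi : PicAut := sg1 * sg2 * sg1 * sg2 * w3 * w1 * w2 * w0
/-- `η⁎ = σ₁σ₂w₂w₁w₀`. -/
def eta : PicAut := sg1 * sg2 * w2 * w1 * w0

lemma trace_psi : Matrix.trace psi.val = 6 := by decide +kernel

lemma trace_eta : Matrix.trace eta.val = 4 := by decide +kernel

/-- `ψ⁎` and `η⁎` are not conjugate in `Ŵ`. -/
theorem stmt17 : ∀ w ∈ Wh, w * psi * w⁻¹ ≠ eta := by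
  intro w _ h
  have hconj : Matrix.trace eta.val = Matrix.trace psi.val := by
    rw [← h, Units.val_mul, Units.val_mul, Matrix.trace_units_conj]
  rw [trace_psi, trace_eta] at hconj
  norm_num at hconj
end

section
/- Sequences a0, a1, a2, a3 : ℕ → ℂ satisfy the system a0(n+1) = 1 − a1(n), a1(n+1) = −a0(n), a2(n+1) = 1 − a3(n), a3(n+1) = −a2(n) for all n ≥ 0 if and only if there exist constants C1, C2, C3, C4 ∈ ℂ such that for all n: a0(n) = n/2 + ((−1)^n − 1)/4 + ((−1)^n + 1)C1/2 + ((−1)^n − 1)C2/2, a1(n) = −n/2 + ((−1)^n + 3)/4 + ((−1)^n − 1)C1/2 + ((−1)^n + 1)C2/2, a2(n) = n/2 + ((−1)^n − 1)/4 + ((−1)^n + 1)C3/2 + ((−1)^n − 1)C4/2, and a3(n) = −n/2 + ((−1)^n + 3)/4 + ((−1)^n − 1)C3/2 + ((−1)^n + 1)C4/2. -/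
/-- General solution of the two-variable system `a(n+1) = 1 - b(n)`, `b(n+1) = -a(n)`. -/
theorem pair_recurrence_iff (a b : ℕ → ℂ) :
    (∀ n : ℕ, a (n + 1) = 1 - b n ∧ b (n + 1) = -a n) ↔
    ∃ C D : ℂ, ∀ n : ℕ,
      a n = (n : ℂ) / 2 + ((-1 : ℂ) ^ n - 1) / 4 +
        ((-1 : ℂ) ^ n + 1) * C / 2 + ((-1 : ℂ) ^ n - 1) * D / 2 ∧
      b n = -(n : ℂ) / 2 + ((-1 : ℂ) ^ n + 3) / 4 +
        ((-1 : ℂ) ^ n - 1) * C / 2 + ((-1 : ℂ) ^ n + 1) * D / 2 := by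
  constructor
  · intro h
    refine ⟨a 0, b 0 - 1, fun n => ?_⟩
    induction n with
    | zero => constructor <;> norm_num
    | succ k ih =>
      rw [(h k).1, (h k).2, ih.1, ih.2]
      push_cast
      constructor <;> ring
  · rintro ⟨C, D, h⟩ n
    rw [(h (n + 1)).1, (h (n + 1)).2, (h n).1, (h n).2]
    push_cast
    constructor <;> ring

/-- General solution of the root-variable evolution
`a₀(n+1) = 1 - a₁(n)`, `a₁(n+1) = -a₀(n)`, `a₂(n+1) = 1 - a₃(n)`,
`a₃(n+1) = -a₂(n)` of the d-PII quasi-translation. -/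
theorem stmt18 (a0 a1 a2 a3 : ℕ → ℂ) :
    (∀ n : ℕ, a0 (n + 1) = 1 - a1 n ∧ a1 (n + 1) = -a0 n ∧
      a2 (n + 1) = 1 - a3 n ∧ a3 (n + 1) = -a2 n) ↔
    ∃ C1 C2 C3 C4 : ℂ, ∀ n : ℕ,
      a0 n = (n : ℂ) / 2 + ((-1 : ℂ) ^ n - 1) / 4 +
        ((-1 : ℂ) ^ n + 1) * C1 / 2 + ((-1 : ℂ) ^ n - 1) * C2 / 2 ∧
      a1 n = -(n : ℂ) / 2 + ((-1 : ℂ) ^ n + 3) / 4 +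
        ((-1 : ℂ) ^ n - 1) * C1 / 2 + ((-1 : ℂ) ^ n + 1) * C2 / 2 ∧
      a2 n = (n : ℂ) / 2 + ((-1 : ℂ) ^ n - 1) / 4 +
        ((-1 : ℂ) ^ n + 1) * C3 / 2 + ((-1 : ℂ) ^ n - 1) * C4 / 2 ∧
      a3 n = -(n : ℂ) / 2 + ((-1 : ℂ) ^ n + 3) / 4 +
        ((-1 : ℂ) ^ n - 1) * C3 / 2 + ((-1 : ℂ) ^ n + 1) * C4 / 2 := by
  constructor
  · intro h
    obtain ⟨C1, C2, h01⟩ :=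
      (pair_recurrence_iff a0 a1).1 fun n => ⟨(h n).1, (h n).2.1⟩
    obtain ⟨C3, C4, h23⟩ := (pair_recurrence_iff a2 a3).1 fun n => (h n).2.2
    exact ⟨C1, C2, C3, C4, fun n => ⟨(h01 n).1, (h01 n).2, h23 n⟩⟩
  · rintro ⟨C1, C2, C3, C4, h⟩ n
    have h01 := (pair_recurrence_iff a0 a1).2
      ⟨C1, C2, fun k => ⟨(h k).1, (h k).2.1⟩⟩ n
    exact ⟨h01.1, h01.2,
      (pair_recurrence_iff a2 a3).2 ⟨C3, C4, fun k => (h k).2.2⟩ n⟩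
end
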